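/- Let H be a bialgebra over a field k and let C be a left partial H-comodule coalgebra with coaction λ(c) = c⁽⁻¹⁾ ⊗ c⁽⁰⁾. Then the linear map ψ: C → H defined by ψ(c) = c⁽⁻¹⁾ε(c⁽⁰⁾) is an idempotent for the convolution product in Hom_k(C, H); that is, ψ(c₍₁₎)ψ(c₍₂₎) = ψ(c) for all c ∈ C. -/

import Mathlib

open TensorProduct

/-- The map `H ⊗ C → H`, `x ⊗ c ↦ ε(c)x`. -/
noncomputable def psiHC (k : Type*) [Field k] {H C : Type*}
    [AddCommGroup H] [Module k H]
    [AddCommGroup C] [Module k C] [Coalgebra k C] : H ⊗[k] C →ₗ[k] H :=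
  (TensorProduct.rid k H).toLinearMap ∘ₗ TensorProduct.map LinearMap.id Coalgebra.counit

/-- The map `H ⊗ (H ⊗ M) → H ⊗ M`, `x ⊗ (y ⊗ m) ↦ xy ⊗ m`. -/
noncomputable def mulFirst (k : Type*) [Field k] {H M : Type*} [Ring H] [Algebra k H]
    [AddCommGroup M] [Module k M] : H ⊗[k] (H ⊗[k] M) →ₗ[k] H ⊗[k] M :=
  TensorProduct.map (LinearMap.mul' k H) LinearMap.id ∘ₗ
    (TensorProduct.assoc k H H M).symm.toLinearMap

/-- A left partial `H`-comodule coalgebra over a bialgebra `H`: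
(PLHCC1) `(id ⊗ Δ)λ(c) = ∑ c₍₁₎⁽⁻¹⁾c₍₂₎⁽⁻¹⁾ ⊗ c₍₁₎⁽⁰⁾ ⊗ c₍₂₎⁽⁰⁾`;
(PLHCC2) `(ε ⊗ id)λ(c) = c`;
(PLHCC3) `(id ⊗ λ)λ(c) = ∑ c₍₁₎⁽⁻¹⁾ε(c₍₁₎⁽⁰⁾)(c₍₂₎⁽⁻¹⁾)₍₁₎ ⊗ (c₍₂₎⁽⁻¹⁾)₍₂₎ ⊗ c₍₂₎⁽⁰⁾`. -/
structure IsPartialComoduleCoalgebra (k : Type*) [Field k] {H C : Type*} [Ring H] [Bialgebra k H]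
    [AddCommGroup C] [Module k C] [Coalgebra k C] (lam : C →ₗ[k] H ⊗[k] C) : Prop where
  plhcc1 : ∀ c : C,
    TensorProduct.map LinearMap.id (Coalgebra.comul (R := k)) (lam c) =
    TensorProduct.map (LinearMap.mul' k H) LinearMap.id
      ((TensorProduct.tensorTensorTensorComm k H C H C)
        (TensorProduct.map lam lam (Coalgebra.comul (R := k) c)))
  plhcc2 : ∀ c : C,
    (TensorProduct.lid k C) (TensorProduct.map Coalgebra.counit LinearMap.id (lam c)) = c
  plhcc3 : ∀ c : C,
    TensorProduct.map LinearMap.id lam (lam c) =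
    mulFirst k (TensorProduct.map (psiHC k)
      ((TensorProduct.assoc k H H C).toLinearMap ∘ₗ
        TensorProduct.map (Coalgebra.comul (R := k)) LinearMap.id)
      (TensorProduct.map lam lam (Coalgebra.comul (R := k) c)))

/-- The symmetric axiom (PLHCC3') for a left partial `H`-comodule coalgebra:
`(id ⊗ λ)λ(c) = ∑ (c₍₁₎⁽⁻¹⁾)₍₁₎c₍₂₎⁽⁻¹⁾ε(c₍₂₎⁽⁰⁾) ⊗ (c₍₁₎⁽⁻¹⁾)₍₂₎ ⊗ c₍₁₎⁽⁰⁾`. -/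
def PLHCC3' (k : Type*) [Field k] {H C : Type*} [Ring H] [Bialgebra k H]
    [AddCommGroup C] [Module k C] [Coalgebra k C] (lam : C →ₗ[k] H ⊗[k] C) : Prop :=
  ∀ c : C,
    TensorProduct.map LinearMap.id lam (lam c) =
    mulFirst k ((TensorProduct.map LinearMap.id
        (TensorProduct.comm k (H ⊗[k] C) H).toLinearMap)
      ((TensorProduct.assoc k H (H ⊗[k] C) H)
        (TensorProduct.map
          ((TensorProduct.assoc k H H C).toLinearMap ∘ₗ
            TensorProduct.map (Coalgebra.comul (R := k)) LinearMap.id)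
          (psiHC k)
          (TensorProduct.map lam lam (Coalgebra.comul (R := k) c)))))

/-- Applying `id ⊗ (ε ⊗ ε)` after `id ⊗ Δ` is the same as applying `id ⊗ ε`. -/
theorem psiHC_map_id_comul (k : Type*) [Field k] {H C : Type*}
    [AddCommGroup H] [Module k H] [AddCommGroup C] [Module k C] [Coalgebra k C]
    (x : H ⊗[k] C) :
    psiHC k (TensorProduct.map LinearMap.id (Coalgebra.comul (R := k)) x) =
      psiHC k x := by
  induction x with
  | zero => simp
  | add x y hx hy => simp only [map_add, hx, hy]
  | tmul h c =>
    have hc : Coalgebra.counit (R := k) (Coalgebra.comul (R := k) c) =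
        Coalgebra.counit (R := k) c := by
      let r := Coalgebra.Repr.arbitrary k c
      rw [← congrArg (Coalgebra.counit (R := k)) (Coalgebra.sum_counit_smul r), ← r.eq]
      simp [mul_comm]
    simp [psiHC, hc]

/-- Multiplying the `H`-legs and then applying the counits agrees with applying the counits to
each factor and then multiplying. -/
theorem psiHC_map_mul_tensorTensorTensorComm (k : Type*) [Field k] {H C : Type*}
    [Ring H] [Algebra k H] [AddCommGroup C] [Module k C] [Coalgebra k C]
    (x : (H ⊗[k] C) ⊗[k] (H ⊗[k] C)) :
    psiHC k (TensorProduct.map (LinearMap.mul' k H) LinearMap.id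
      (TensorProduct.tensorTensorTensorComm k H C H C x)) =
      LinearMap.mul' k H (TensorProduct.map (psiHC k) (psiHC k) x) := by
  suffices h : psiHC k ∘ₗ TensorProduct.map (LinearMap.mul' k H) LinearMap.id ∘ₗ
      (TensorProduct.tensorTensorTensorComm k H C H C).toLinearMap =
      LinearMap.mul' k H ∘ₗ TensorProduct.map (psiHC k) (psiHC k) from
    LinearMap.congr_fun h x
  ext a c b d
  simp [psiHC, smul_smul, mul_comm]

/-- For a left partial `H`-comodule coalgebra `C` over a bialgebra `H`, the map
`ψ : C → H`, `ψ(c) = c⁽⁻¹⁾ε(c⁽⁰⁾)`, is an idempotent in the convolution algebra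
`Hom_k(C,H)`, i.e. `∑ ψ(c₍₁₎)ψ(c₍₂₎) = ψ(c)` for all `c`. -/
theorem partialComoduleCoalgebra_psi_convolution_idempotent
    {k H C : Type*} [Field k] [Ring H] [Bialgebra k H]
    [AddCommGroup C] [Module k C] [Coalgebra k C]
    (lam : C →ₗ[k] H ⊗[k] C) (hlam : IsPartialComoduleCoalgebra k lam) :
    ∀ c : C,
      (LinearMap.mul' k H)
        (TensorProduct.map (psiHC k ∘ₗ lam) (psiHC k ∘ₗ lam) (Coalgebra.comul (R := k) c)) =
      psiHC k (lam c) := by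
  intro c
  rw [← psiHC_map_id_comul k (lam c), hlam.plhcc1 c, psiHC_map_mul_tensorTensorTensorComm,
    TensorProduct.map_comp, LinearMap.comp_apply]
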